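/- The two-dimensional Silver Dollar game without pushing and with jumps allowed, in which a coin may also be moved off the board (and is then removed from play), has the same set of P-positions as the variant of the game in which moving a coin off the board is illegal; i.e., a position (w,x,y,z) with both coins on the board is a P-position of the first game if and only if it is a P-position of the second game. Consequently, the coin game is mathematically the same as Corner the Two Rooks under the coordinate shift (w,x,y,z) ↦ (w-1,x-1,y-1,z-1). -/

import Mathlib

mutual
  /-- P-position: the previous player (who just moved) can force a win. -/
  inductive PPosition {α : Type} (Move : α → α → Prop) : α → Prop
    | intro (p : α) (h : ∀ q, Move p q → NPosition Move q) : PPosition Move p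
  /-- N-position: the player to move can force a win. -/
  inductive NPosition {α : Type} (Move : α → α → Prop) : α → Prop
    | intro (p q : α) (h : Move p q) (hq : PPosition Move q) : NPosition Move p
end

/-- A coin on the board at column `w`, row `x` (both `≥ 1` when on the board);
if either coordinate is `0` the coin has slid off the board and is removed (`none`). -/
def coin (w x : ℕ) : Option (ℕ × ℕ) := if w = 0 ∨ x = 0 then none else some (w, x)

/-- Moves of the two-dimensional Silver Dollar game without pushing: a move slides one
coin any number of squares to the left or upward; a coin slid off the board is removed;
a coin may jump over the other coin but may not land on it. -/
inductive JumpMove :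
    Option (ℕ × ℕ) × Option (ℕ × ℕ) → Option (ℕ × ℕ) × Option (ℕ × ℕ) → Prop
  | left₁ (w x t : ℕ) (c : Option (ℕ × ℕ)) (ht : t < w)
      (hc : coin t x = none ∨ coin t x ≠ c) :
      JumpMove (some (w, x), c) (coin t x, c)
  | up₁ (w x t : ℕ) (c : Option (ℕ × ℕ)) (ht : t < x)
      (hc : coin w t = none ∨ coin w t ≠ c) :
      JumpMove (some (w, x), c) (coin w t, c)
  | left₂ (w x t : ℕ) (c : Option (ℕ × ℕ)) (ht : t < w)
      (hc : coin t x = none ∨ coin t x ≠ c) :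
      JumpMove (c, some (w, x)) (c, coin t x)
  | up₂ (w x t : ℕ) (c : Option (ℕ × ℕ)) (ht : t < x)
      (hc : coin w t = none ∨ coin w t ≠ c) :
      JumpMove (c, some (w, x)) (c, coin w t)

/-- The variant of the game in which moving a coin off the board is illegal:
the target square must still have positive coordinates. -/
inductive JumpMoveNoDrop :
    Option (ℕ × ℕ) × Option (ℕ × ℕ) → Option (ℕ × ℕ) × Option (ℕ × ℕ) → Prop
  | left₁ (w x t : ℕ) (c : Option (ℕ × ℕ)) (ht0 : 1 ≤ t) (ht : t < w)
      (hc : c ≠ some (t, x)) :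
      JumpMoveNoDrop (some (w, x), c) (some (t, x), c)
  | up₁ (w x t : ℕ) (c : Option (ℕ × ℕ)) (ht0 : 1 ≤ t) (ht : t < x)
      (hc : c ≠ some (w, t)) :
      JumpMoveNoDrop (some (w, x), c) (some (w, t), c)
  | left₂ (w x t : ℕ) (c : Option (ℕ × ℕ)) (ht0 : 1 ≤ t) (ht : t < w)
      (hc : c ≠ some (t, x)) :
      JumpMoveNoDrop (c, some (w, x)) (c, some (t, x))
  | up₂ (w x t : ℕ) (c : Option (ℕ × ℕ)) (ht0 : 1 ≤ t) (ht : t < x)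
      (hc : c ≠ some (w, t)) :
      JumpMoveNoDrop (c, some (w, x)) (c, some (w, t))

/-- Moves of "Corner the Two Rooks": a move strictly decreases exactly one coordinate
of exactly one rook, and the two rooks may never occupy the same square. -/
def RookMove : ℕ × ℕ × ℕ × ℕ → ℕ × ℕ × ℕ × ℕ → Prop :=
  fun (x, y, z, w) (x', y', z', w') =>
    (x', y') ≠ (z', w') ∧
      (((z', w') = (z, w) ∧ ((y' = y ∧ x' < x) ∨ (x' = x ∧ y' < y))) ∨
        ((x', y') = (x, y) ∧ ((w' = w ∧ z' < z) ∨ (z' = z ∧ w' < w))))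

section Simulation

variable {α β : Type} {A : α → α → Prop} {B : β → β → Prop} {R : α → β → Prop}

/-- `R` is a bisimulation between the games `A` and `B`, except that `A` may have additional moves
to positions that are won by the player to move. -/
structure IsBisimUpToLosingMoves (A : α → α → Prop) (B : β → β → Prop) (R : α → β → Prop) :
    Prop where
  forth : ∀ {a b a'}, R a b → A a a' →
    (∃ b', B b b' ∧ R a' b') ∨ (NPosition A a' ∧ ¬ PPosition A a')
  back : ∀ {a b b'}, R a b → B b b' → ∃ a', A a a' ∧ R a' b'

mutual
  theorem IsBisimUpToLosingMoves.pPosition_right (hR : IsBisimUpToLosingMoves A B R) :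
      ∀ {a b}, PPosition A a → R a b → PPosition B b
    | _, _, .intro _ h, hab => .intro _ fun _ hb =>
      have ⟨_, ha, hab'⟩ := hR.back hab hb
      IsBisimUpToLosingMoves.nPosition_right hR (h _ ha) hab'
  theorem IsBisimUpToLosingMoves.nPosition_right (hR : IsBisimUpToLosingMoves A B R) :
      ∀ {a b}, NPosition A a → R a b → NPosition B b
    | _, _, .intro _ _ h hq, hab =>
      match hR.forth hab h with
      | .inl ⟨_, hb, hab'⟩ =>
        .intro _ _ hb (IsBisimUpToLosingMoves.pPosition_right hR hq hab')
      | .inr hn => absurd hq hn.2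
end

mutual
  theorem IsBisimUpToLosingMoves.pPosition_left (hR : IsBisimUpToLosingMoves A B R) :
      ∀ {a b}, PPosition B b → R a b → PPosition A a
    | _, _, .intro _ h, hab => .intro _ fun _ ha =>
      match hR.forth hab ha with
      | .inl ⟨_, hb, hab'⟩ => IsBisimUpToLosingMoves.nPosition_left hR (h _ hb) hab'
      | .inr hn => hn.1
  theorem IsBisimUpToLosingMoves.nPosition_left (hR : IsBisimUpToLosingMoves A B R) :
      ∀ {a b}, NPosition B b → R a b → NPosition A a
    | _, _, .intro _ _ h hq, hab =>
      have ⟨_, ha, hab'⟩ := hR.back hab h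
      .intro _ _ ha (IsBisimUpToLosingMoves.pPosition_left hR hq hab')
end

theorem IsBisimUpToLosingMoves.pPosition_iff (hR : IsBisimUpToLosingMoves A B R) {a : α} {b : β}
    (hab : R a b) : PPosition A a ↔ PPosition B b :=
  ⟨fun h => hR.pPosition_right h hab, fun h => hR.pPosition_left h hab⟩

end Simulation

theorem coin_zero_left (x : ℕ) : coin 0 x = none := by simp [coin]

theorem coin_zero_right (w : ℕ) : coin w 0 = none := by simp [coin]

theorem coin_succ_succ (w x : ℕ) : coin (w + 1) (x + 1) = some (w + 1, x + 1) := by simp [coin]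

theorem pPosition_jumpMove_none : PPosition JumpMove (none, none) :=
  .intro _ fun _ h => nomatch h

theorem not_nPosition_jumpMove_none : ¬ NPosition JumpMove (none, none) :=
  fun ⟨_, _, h, _⟩ => nomatch h

theorem jumpMove_drop_left (w x : ℕ) (c : Option (ℕ × ℕ)) :
    JumpMove (some (w + 1, x), c) (none, c) := by
  simpa [coin_zero_left] using JumpMove.left₁ (w + 1) x 0 c (by omega) (by simp [coin_zero_left])

theorem jumpMove_drop_right (w x : ℕ) (c : Option (ℕ × ℕ)) :
    JumpMove (c, some (w + 1, x)) (c, none) := by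
  simpa [coin_zero_left] using JumpMove.left₂ (w + 1) x 0 c (by omega) (by simp [coin_zero_left])

/-- A position with a single coin on the board is won by the player to move, who removes it. -/
theorem single_coin_left_wins (w x : ℕ) :
    NPosition JumpMove (some (w + 1, x), none) ∧ ¬ PPosition JumpMove (some (w + 1, x), none) :=
  ⟨.intro _ _ (jumpMove_drop_left w x none) pPosition_jumpMove_none,
    fun ⟨_, h⟩ => not_nPosition_jumpMove_none (h _ (jumpMove_drop_left w x none))⟩

theorem single_coin_right_wins (w x : ℕ) :
    NPosition JumpMove (none, some (w + 1, x)) ∧ ¬ PPosition JumpMove (none, some (w + 1, x)) :=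
  ⟨.intro _ _ (jumpMove_drop_right w x none) pPosition_jumpMove_none,
    fun ⟨_, h⟩ => not_nPosition_jumpMove_none (h _ (jumpMove_drop_right w x none))⟩

/-- The silver dollar position whose coins are at the given squares of a board indexed from zero. -/
def toCoins : ℕ × ℕ × ℕ × ℕ → Option (ℕ × ℕ) × Option (ℕ × ℕ) :=
  fun (w, x, y, z) => (some (w + 1, x + 1), some (y + 1, z + 1))

theorem rookMove_or_wins_of_jumpMove_toCoins {p : ℕ × ℕ × ℕ × ℕ} {q : Option (ℕ × ℕ) × Option (ℕ × ℕ)}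
    (h : JumpMove (toCoins p) q) :
    (∃ r, RookMove p r ∧ q = toCoins r) ∨ (NPosition JumpMove q ∧ ¬ PPosition JumpMove q) := by
  obtain ⟨w, x, y, z⟩ := p
  generalize hp : toCoins (w, x, y, z) = p' at h
  cases h with
  | left₁ w' x' t c ht hc =>
    simp only [toCoins, Prod.mk.injEq, Option.some.injEq] at hp
    obtain ⟨⟨rfl, rfl⟩, rfl⟩ := hp
    cases t with
    | zero => right; simpa [coin_zero_left] using single_coin_right_wins y (z + 1)
    | succ t =>
      left
      simp only [coin_succ_succ] at hc ⊢
      exact ⟨(t, x, y, z), by simp_all [RookMove], rfl⟩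
  | up₁ w' x' t c ht hc =>
    simp only [toCoins, Prod.mk.injEq, Option.some.injEq] at hp
    obtain ⟨⟨rfl, rfl⟩, rfl⟩ := hp
    cases t with
    | zero => right; simpa [coin_zero_right] using single_coin_right_wins y (z + 1)
    | succ t =>
      left
      simp only [coin_succ_succ] at hc ⊢
      exact ⟨(w, t, y, z), by simp_all [RookMove], rfl⟩
  | left₂ w' x' t c ht hc =>
    simp only [toCoins, Prod.mk.injEq, Option.some.injEq] at hp
    obtain ⟨rfl, rfl, rfl⟩ := hp
    cases t with
    | zero => right; simpa [coin_zero_left] using single_coin_left_wins w (x + 1)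
    | succ t =>
      left
      simp only [coin_succ_succ] at hc ⊢
      exact ⟨(w, x, t, z), by simp [RookMove] at hc ⊢; omega, rfl⟩
  | up₂ w' x' t c ht hc =>
    simp only [toCoins, Prod.mk.injEq, Option.some.injEq] at hp
    obtain ⟨rfl, rfl, rfl⟩ := hp
    cases t with
    | zero => right; simpa [coin_zero_right] using single_coin_left_wins w (x + 1)
    | succ t =>
      left
      simp only [coin_succ_succ] at hc ⊢
      exact ⟨(w, x, y, t), by simp [RookMove] at hc ⊢; omega, rfl⟩

theorem jumpMoveNoDrop_toCoins_iff {p : ℕ × ℕ × ℕ × ℕ} {q : Option (ℕ × ℕ) × Option (ℕ × ℕ)} :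
    JumpMoveNoDrop (toCoins p) q ↔ ∃ r, RookMove p r ∧ q = toCoins r := by
  obtain ⟨w, x, y, z⟩ := p
  constructor
  · intro h
    generalize hp : toCoins (w, x, y, z) = p' at h
    cases h with
    | left₁ w' x' t c ht0 ht hc =>
      obtain ⟨t, rfl⟩ := Nat.exists_eq_add_of_le' ht0
      simp only [toCoins, Prod.mk.injEq, Option.some.injEq] at hp
      obtain ⟨⟨rfl, rfl⟩, rfl⟩ := hp
      exact ⟨(t, x, y, z), by simp [RookMove] at hc ⊢; omega, rfl⟩
    | up₁ w' x' t c ht0 ht hc =>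
      obtain ⟨t, rfl⟩ := Nat.exists_eq_add_of_le' ht0
      simp only [toCoins, Prod.mk.injEq, Option.some.injEq] at hp
      obtain ⟨⟨rfl, rfl⟩, rfl⟩ := hp
      exact ⟨(w, t, y, z), by simp [RookMove] at hc ⊢; omega, rfl⟩
    | left₂ w' x' t c ht0 ht hc =>
      obtain ⟨t, rfl⟩ := Nat.exists_eq_add_of_le' ht0
      simp only [toCoins, Prod.mk.injEq, Option.some.injEq] at hp
      obtain ⟨rfl, rfl, rfl⟩ := hp
      exact ⟨(w, x, t, z), by simp [RookMove] at hc ⊢; omega, rfl⟩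
    | up₂ w' x' t c ht0 ht hc =>
      obtain ⟨t, rfl⟩ := Nat.exists_eq_add_of_le' ht0
      simp only [toCoins, Prod.mk.injEq, Option.some.injEq] at hp
      obtain ⟨rfl, rfl, rfl⟩ := hp
      exact ⟨(w, x, y, t), by simp [RookMove] at hc ⊢; omega, rfl⟩
  · rintro ⟨⟨w', x', y', z'⟩, ⟨hne, h⟩, rfl⟩
    simp only [ne_eq, Prod.mk.injEq] at hne h
    rcases h with ⟨⟨rfl, rfl⟩, ⟨rfl, h⟩ | ⟨rfl, h⟩⟩ | ⟨⟨rfl, rfl⟩, ⟨rfl, h⟩ | ⟨rfl, h⟩⟩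
    · exact .left₁ _ _ _ _ (by omega) (by omega) (by simp; omega)
    · exact .up₁ _ _ _ _ (by omega) (by omega) (by simp; omega)
    · exact .left₂ _ _ _ _ (by omega) (by omega) (by simp; omega)
    · exact .up₂ _ _ _ _ (by omega) (by omega) (by simp; omega)

theorem RookMove.jumpMove_toCoins {p r : ℕ × ℕ × ℕ × ℕ} (h : RookMove p r) :
    JumpMove (toCoins p) (toCoins r) := by
  obtain ⟨w, x, y, z⟩ := p
  obtain ⟨w', x', y', z'⟩ := r
  obtain ⟨hne, h⟩ := h
  simp only [ne_eq, Prod.mk.injEq] at hne h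
  rcases h with ⟨⟨rfl, rfl⟩, ⟨rfl, h⟩ | ⟨rfl, h⟩⟩ | ⟨⟨rfl, rfl⟩, ⟨rfl, h⟩ | ⟨rfl, h⟩⟩
  · simpa only [toCoins, coin_succ_succ] using JumpMove.left₁ (w + 1) (x' + 1) (w' + 1)
      (some (y' + 1, z' + 1)) (by omega) (by simp [coin_succ_succ]; omega)
  · simpa only [toCoins, coin_succ_succ] using JumpMove.up₁ (w' + 1) (x + 1) (x' + 1)
      (some (y' + 1, z' + 1)) (by omega) (by simp [coin_succ_succ]; omega)
  · simpa only [toCoins, coin_succ_succ] using JumpMove.left₂ (y + 1) (z' + 1) (y' + 1)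
      (some (w' + 1, x' + 1)) (by omega) (by simp [coin_succ_succ]; omega)
  · simpa only [toCoins, coin_succ_succ] using JumpMove.up₂ (y' + 1) (z + 1) (z' + 1)
      (some (w' + 1, x' + 1)) (by omega) (by simp [coin_succ_succ]; omega)

theorem isBisimUpToLosingMoves_jumpMove_rookMove :
    IsBisimUpToLosingMoves JumpMove RookMove fun q p => q = toCoins p where
  forth := by
    rintro _ p q rfl h
    exact rookMove_or_wins_of_jumpMove_toCoins h
  back := by
    rintro _ p r rfl h
    exact ⟨_, h.jumpMove_toCoins, rfl⟩

theorem isBisimUpToLosingMoves_jumpMoveNoDrop_rookMove :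
    IsBisimUpToLosingMoves JumpMoveNoDrop RookMove fun q p => q = toCoins p where
  forth := by
    rintro _ p q rfl h
    exact .inl (jumpMoveNoDrop_toCoins_iff.1 h)
  back := by
    rintro _ p r rfl h
    exact ⟨_, jumpMoveNoDrop_toCoins_iff.2 ⟨r, h, rfl⟩, rfl⟩

/-- The two-dimensional Silver Dollar game without pushing has the same P-positions as
the variant in which moving a coin off the board is illegal; consequently, under the
coordinate shift `(w,x,y,z) ↦ (w-1,x-1,y-1,z-1)`, it is mathematically the same as
Corner the Two Rooks. -/
theorem silverDollar_eq_noDrop_eq_rooks (w x y z : ℕ)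
    (hw : 1 ≤ w) (hx : 1 ≤ x) (hy : 1 ≤ y) (hz : 1 ≤ z)
    (hne : (w, x) ≠ (y, z)) :
    (PPosition JumpMove (some (w, x), some (y, z)) ↔
      PPosition JumpMoveNoDrop (some (w, x), some (y, z))) ∧
    (PPosition JumpMove (some (w, x), some (y, z)) ↔
      PPosition RookMove (w - 1, x - 1, y - 1, z - 1)) := by
  have hp : (some (w, x), some (y, z)) = toCoins (w - 1, x - 1, y - 1, z - 1) := by
    simp [toCoins, Nat.sub_add_cancel, *]
  have hJ := isBisimUpToLosingMoves_jumpMove_rookMove.pPosition_iff hp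
  have hD := isBisimUpToLosingMoves_jumpMoveNoDrop_rookMove.pPosition_iff hp
  exact ⟨hJ.trans hD.symm, hJ⟩
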